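/- arXiv:2011.13420 — 2 statements merged into one kernel-verified Lean document; each statement's English description precedes it below -/
import Mathlib

section
/- Let n ≥ 2 and k ≥ 1 be integers, γ ∈ ℝ, and for each pair u < v in Fin n let c_{u,v} : ZMod k × ZMod k → ℝ. Define the cost function C(x) = Σ_{u<v} c_{u,v}(x_u, x_v) for x : Fin n → ZMod k, and define the level-1 generalized QAOA vector ψ ∈ ℂ^{(Fin n → ZMod k)} with entries ψ(y) = Σ_{x : Fin n → ZMod k} (Π_{j} B_{y_j, x_j}) · k^{−n/2} e^{iγ C(x)}, where B is any unitary k×k matrix (i.e., ψ = B^{⊗n} e^{iγC} |+⟩^{⊗n}). Then for every k²×k² matrix O (indexed by (ZMod k)²), the expectation of O acting on qudits 1 and 2 satisfies ⟨ψ, (O ⊗ I) ψ⟩ = Tr(η · O), where η = (B ⊗ B) ρ (B ⊗ B)^† and ρ is the matrix with entries ρ_{(c,d),(c',d')} = (1/k²) e^{iγ(c_{1,2}(c,d) − c_{1,2}(c',d'))} · Π_{w=3}^{n} [ (1/k) Σ_{a ∈ ZMod k} e^{iγ(c_{1,w}(c,a) + c_{2,w}(d,a) − c_{1,w}(c',a)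 − c_{2,w}(d',a))} ]. -/
open Matrix Kronecker Finset

/-- Summing over tuples of length `m + 2` amounts to summing over the first two entries and the
remaining tuple. -/
theorem sum_pi_fin_add_two {α M : Type*} [Fintype α] [AddCommMonoid M] {m : ℕ}
    (f : (Fin (m + 2) → α) → M) :
    ∑ x, f x = ∑ p : α × α, ∑ z : Fin m → α,
      f (Fin.cons p.1 (Fin.cons p.2 z : Fin (m + 1) → α)) := by
  rw [← (Fin.consEquiv fun _ : Fin (m + 2) => α).sum_comp, Fintype.sum_prod_type,
    Fintype.sum_prod_type]
  refine Finset.sum_congr rfl fun a _ => ?_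
  rw [← (Fin.consEquiv fun _ : Fin (m + 1) => α).sum_comp, Fintype.sum_prod_type]
  rfl

/-- The sum over ordered pairs splits off the pairs that meet the first two indices. -/
theorem sum_pairs_fin_add_two {M : Type*} [AddCommMonoid M] {m : ℕ}
    (f : Fin (m + 2) → Fin (m + 2) → M) :
    ∑ p ∈ Finset.univ.filter (fun p : Fin (m + 2) × Fin (m + 2) => p.1 < p.2), f p.1 p.2 =
      f 0 1 + ∑ w : Fin m, (f 0 w.succ.succ + f 1 w.succ.succ) +
        ∑ p ∈ Finset.univ.filter (fun p : Fin m × Fin m => p.1 < p.2),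
          f p.1.succ.succ p.2.succ.succ := by
  have h01 : (0 : Fin (m + 2)) < 1 := Fin.zero_lt_one
  have h : ∀ i : Fin m, ¬ i.succ.succ < 1 := fun i => by
    rw [← Fin.succ_zero_eq_one, Fin.succ_lt_succ_iff]
    exact Fin.not_lt_zero _
  simp only [Finset.sum_filter, Fintype.sum_prod_type, Fin.sum_univ_succ, Fin.succ_lt_succ_iff,
    Fin.succ_pos, Fin.not_lt_zero, lt_irrefl, if_true, if_false, zero_add,
    Finset.sum_add_distrib, Fin.succ_zero_eq_one, h01, h, Finset.sum_const_zero]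
  abel

/-- The product over the indices other than the first two. -/
theorem prod_filter_ne_zero_ne_one {M : Type*} [CommMonoid M] {m : ℕ} (f : Fin (m + 2) → M) :
    ∏ w ∈ Finset.univ.filter (fun w : Fin (m + 2) => w ≠ 0 ∧ w ≠ 1), f w =
      ∏ w : Fin m, f w.succ.succ := by
  have h : ∀ i : Fin m, i.succ.succ ≠ 1 := fun i => by
    rw [← Fin.succ_zero_eq_one, Ne, Fin.succ_inj]
    exact Fin.succ_ne_zero _
  simp [Finset.prod_filter, Fin.prod_univ_succ, h, Fin.succ_ne_zero]

/-- The `m`-fold tensor power of a matrix. -/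
def Matrix.tensorPower {α : Type*} (m : ℕ) (B : Matrix α α ℂ) :
    Matrix (Fin m → α) (Fin m → α) ℂ :=
  Matrix.of fun y x => ∏ j, B (y j) (x j)

theorem Matrix.conjTranspose_mul_tensorPower {α : Type*} [Fintype α] [DecidableEq α] (m : ℕ)
    {B : Matrix α α ℂ} (hB : B ∈ Matrix.unitaryGroup α ℂ) :
    (Matrix.tensorPower m B)ᴴ * Matrix.tensorPower m B = 1 := by
  ext x x'
  have h := Matrix.mem_unitaryGroup_iff'.mp hB
  rw [Matrix.star_eq_conjTranspose] at h
  have hentry : ∀ a b, ∑ y, star (B y a) * B y b = if a = b then 1 else 0 := fun a b => by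
    have := congrFun (congrFun h a) b
    simpa [Matrix.mul_apply, Matrix.one_apply] using this
  simp only [Matrix.mul_apply, Matrix.conjTranspose_apply, Matrix.tensorPower, Matrix.of_apply,
    star_prod, ← Finset.prod_mul_distrib]
  rw [← Fintype.prod_sum (fun j y => star (B y (x j)) * B y (x' j))]
  simp only [hentry, Matrix.one_apply, funext_iff]
  split_ifs with hx
  · simp [hx]
  · obtain ⟨j, hj⟩ := not_forall.mp hx
    exact Finset.prod_eq_zero (Finset.mem_univ j) (if_neg hj)

/-- The expectation of `O ⊗ 1` in a bipartite vector is the trace of `O` against the reduced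
density matrix. -/
theorem Matrix.sum_star_mul_eq_trace {α β : Type*} [Fintype α] [Fintype β] [DecidableEq β]
    (Ψ : Matrix α β ℂ) (O : Matrix α α ℂ) :
    ∑ q, ∑ z, star (Ψ q z) * ∑ p, ∑ z', (O q p * if z = z' then 1 else 0) * Ψ p z' =
      Matrix.trace (Ψ * Ψᴴ * O) := by
  rw [Matrix.trace_mul_comm, ← Matrix.mul_assoc, Matrix.trace_mul_comm]
  simp only [mul_ite, mul_one, mul_zero, ite_mul, zero_mul, Finset.sum_ite_eq, Finset.mem_univ,
    if_true, Matrix.trace, Matrix.diag_apply, Matrix.mul_apply, Matrix.conjTranspose_apply]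
  exact Finset.sum_comm

/-- A unitary acting on the traced-out factor does not change the reduced density matrix. -/
theorem Matrix.mul_conjTranspose_of_unitary_right {α β : Type*} [Fintype α] [Fintype β]
    [DecidableEq β] (A : Matrix α α ℂ) (Φ : Matrix α β ℂ) {U : Matrix β β ℂ} (hU : Uᴴ * U = 1) :
    (A * Φ * Uᵀ) * (A * Φ * Uᵀ)ᴴ = A * (Φ * Φᴴ) * Aᴴ := by
  have h : Uᵀ * (Uᵀ)ᴴ = 1 := by
    change Uᵀ * (Uᴴ)ᵀ = 1
    rw [← Matrix.transpose_mul, hU, Matrix.transpose_one]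
  calc (A * Φ * Uᵀ) * (A * Φ * Uᵀ)ᴴ = A * Φ * (Uᵀ * (Uᵀ)ᴴ) * (Φᴴ * Aᴴ) := by
        simp only [Matrix.conjTranspose_mul, Matrix.mul_assoc]
    _ = A * (Φ * Φᴴ) * Aᴴ := by
        rw [h]
        simp only [Matrix.mul_one, Matrix.mul_assoc]

/-- Correctness of the classical simulation of level-1 generalized-QAOA
expectation values: for the level-1 QAOA vector `ψ = B^{⊗n} e^{iγC} |+⟩^{⊗n}` built from a
2-local cost function `C(x) = Σ_{u<v} c_{u,v}(x_u, x_v)` and any unitary `B`, and any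
two-qudit observable `O` acting on qudits `1` and `2` (indices `i0 = 0`, `i1 = 1`),
`⟨ψ, (O ⊗ I)ψ⟩ = Tr(η O)` where `η = (B ⊗ B) ρ (B ⊗ B)†` and `ρ` is given by the explicit
product formula over the remaining qudits. -/
theorem level_one_qaoa_expectation (n k : ℕ) (hn : 2 ≤ n) [NeZero k] (γ : ℝ)
    (c : Fin n → Fin n → ZMod k → ZMod k → ℝ)
    (B : Matrix (ZMod k) (ZMod k) ℂ) (hB : B ∈ Matrix.unitaryGroup (ZMod k) ℂ)
    (O : Matrix (ZMod k × ZMod k) (ZMod k × ZMod k) ℂ) :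
    let i0 : Fin n := ⟨0, by omega⟩
    let i1 : Fin n := ⟨1, by omega⟩
    let C : (Fin n → ZMod k) → ℝ := fun x =>
      ∑ p ∈ Finset.univ.filter (fun p : Fin n × Fin n => p.1 < p.2),
        c p.1 p.2 (x p.1) (x p.2)
    let ψ : (Fin n → ZMod k) → ℂ := fun y =>
      ∑ x : Fin n → ZMod k,
        (∏ j : Fin n, B (y j) (x j)) *
          ((((Real.sqrt k) ^ n : ℝ) : ℂ)⁻¹ * Complex.exp (Complex.I * (γ : ℂ) * ((C x : ℝ) : ℂ)))
    let ρ : Matrix (ZMod k × ZMod k) (ZMod k × ZMod k) ℂ :=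
      Matrix.of fun p q : ZMod k × ZMod k =>
        (1 / ((k : ℂ) ^ 2)) *
          Complex.exp (Complex.I * (γ : ℂ) *
            (((c i0 i1 p.1 p.2 - c i0 i1 q.1 q.2 : ℝ) : ℂ))) *
          ∏ w ∈ Finset.univ.filter (fun w : Fin n => w ≠ i0 ∧ w ≠ i1),
            ((1 / (k : ℂ)) * ∑ a : ZMod k,
              Complex.exp (Complex.I * (γ : ℂ) *
                (((c i0 w p.1 a + c i1 w p.2 a - c i0 w q.1 a - c i1 w q.2 a : ℝ) : ℂ))))
    let η : Matrix (ZMod k × ZMod k) (ZMod k × ZMod k) ℂ := (B ⊗ₖ B) * ρ * (B ⊗ₖ B)ᴴ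
    (∑ y : Fin n → ZMod k, (starRingEnd ℂ) (ψ y) *
        ∑ x : Fin n → ZMod k,
          (O (y i0, y i1) (x i0, x i1) *
            (if ∀ j : Fin n, j ≠ i0 → j ≠ i1 → y j = x j then 1 else 0)) * ψ x)
      = Matrix.trace (η * O) := by
  intro i0 i1 C ψ ρ η
  obtain ⟨m, rfl⟩ := Nat.exists_eq_add_of_le' hn
  have hi0 : i0 = 0 := rfl
  have hi1 : i1 = 1 := rfl
  let s : ℂ := (((Real.sqrt k) ^ (m + 2) : ℝ) : ℂ)⁻¹
  let join : ZMod k × ZMod k → (Fin m → ZMod k) → Fin (m + 2) → ZMod k :=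
    fun p z => Fin.cons p.1 (Fin.cons p.2 z : Fin (m + 1) → ZMod k)
  have hj0 : ∀ p z, join p z 0 = p.1 := fun _ _ => rfl
  have hj1 : ∀ p z, join p z 1 = p.2 := fun _ _ => rfl
  have hjs : ∀ p z w, join p z (Fin.succ (Fin.succ w)) = z w := fun _ _ _ => rfl
  let Φ : Matrix (ZMod k × ZMod k) (Fin m → ZMod k) ℂ :=
    Matrix.of fun p z => s * Complex.exp (Complex.I * (γ : ℂ) * ((C (join p z) : ℝ) : ℂ))
  let Ψ : Matrix (ZMod k × ZMod k) (Fin m → ZMod k) ℂ := Matrix.of fun p z => ψ (join p z)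
  have hΨ : Ψ = (B ⊗ₖ B) * Φ * (Matrix.tensorPower m B)ᵀ := by
    ext p z
    simp only [Ψ, ψ, Φ, Matrix.of_apply, Matrix.mul_apply, Matrix.transpose_apply,
      Matrix.tensorPower, Matrix.kroneckerMap_apply, Finset.sum_mul]
    rw [sum_pi_fin_add_two, Finset.sum_comm]
    refine Finset.sum_congr rfl fun z' _ => Finset.sum_congr rfl fun p' _ => ?_
    change (∏ j, B (join p z j) (join p' z' j)) * (s * _) = _
    rw [Fin.prod_univ_succ, Fin.prod_univ_succ]
    change B p.1 p'.1 * (B p.2 p'.2 * ∏ j, B (z j) (z' j)) * (s * _) = _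
    ring
  have hC : ∀ p z, C (join p z) = c 0 1 p.1 p.2 +
      ∑ w : Fin m, (c 0 w.succ.succ p.1 (z w) + c 1 w.succ.succ p.2 (z w)) +
        ∑ e ∈ Finset.univ.filter (fun e : Fin m × Fin m => e.1 < e.2),
          c e.1.succ.succ e.2.succ.succ (z e.1) (z e.2) := fun p z =>
    sum_pairs_fin_add_two fun u v => c u v (join p z u) (join p z v)
  have hs : s * star s = 1 / (k : ℂ) ^ 2 * (1 / (k : ℂ)) ^ m := by
    have hsq : ((Real.sqrt k : ℝ) : ℂ) * ((Real.sqrt k : ℝ) : ℂ) = k := by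
      rw [← Complex.ofReal_mul, Real.mul_self_sqrt (Nat.cast_nonneg k), Complex.ofReal_natCast]
    have hstar : star s = s := by
      simp only [s, ← Complex.ofReal_inv]
      exact Complex.conj_ofReal _
    rw [hstar]
    simp only [s, Complex.ofReal_pow]
    rw [← mul_inv, ← mul_pow, hsq, _root_.one_div_pow, one_div, one_div, ← mul_inv, ← pow_add,
      Nat.add_comm]
  have hρ : ρ = Φ * Φᴴ := by
    ext p q
    have hterm : ∀ z, Φ p z * star (Φ q z) = s * star s *
        (Complex.exp (Complex.I * (γ : ℂ) * ((c 0 1 p.1 p.2 - c 0 1 q.1 q.2 : ℝ) : ℂ)) *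
          ∏ w : Fin m, Complex.exp (Complex.I * (γ : ℂ) *
            ((c 0 w.succ.succ p.1 (z w) + c 1 w.succ.succ p.2 (z w) -
              c 0 w.succ.succ q.1 (z w) - c 1 w.succ.succ q.2 (z w) : ℝ) : ℂ))) := fun z => by
      have hconj : star (Complex.exp (Complex.I * (γ : ℂ) * ((C (join q z) : ℝ) : ℂ))) =
          Complex.exp (-(Complex.I * (γ : ℂ) * ((C (join q z) : ℝ) : ℂ))) := by
        change (starRingEnd ℂ) _ = _
        rw [← Complex.exp_conj]
        simp
      simp only [Φ, Matrix.of_apply, star_mul', hconj]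
      rw [mul_mul_mul_comm, ← Complex.exp_add, ← Complex.exp_sum, ← Complex.exp_add, hC, hC,
        ← Finset.mul_sum]
      congr 2
      push_cast
      simp only [Finset.sum_add_distrib, Finset.sum_sub_distrib]
      ring
    simp only [Matrix.mul_apply, Matrix.conjTranspose_apply, hterm, hs, ρ, Matrix.of_apply, hi0,
      hi1]
    rw [prod_filter_ne_zero_ne_one, Finset.prod_mul_distrib, Finset.prod_const, Finset.card_univ,
      Fintype.card_fin, Fintype.prod_sum, ← Finset.mul_sum, ← Finset.mul_sum]
    ring
  have hη : η = Ψ * Ψᴴ := by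
    rw [hΨ, Matrix.mul_conjTranspose_of_unitary_right _ _
      (Matrix.conjTranspose_mul_tensorPower m hB), ← hρ]
  have hif : ∀ q p z z', (∀ j : Fin (m + 2), j ≠ 0 → j ≠ 1 → join q z j = join p z' j) ↔
      z = z' := fun q p z z' => by
    simp only [Fin.forall_fin_succ (n := m + 1), Fin.forall_fin_succ (n := m), hjs, funext_iff]
    have h : ∀ i : Fin m, i.succ.succ ≠ 1 := fun i => by
      rw [← Fin.succ_zero_eq_one, Ne, Fin.succ_inj]
      exact Fin.succ_ne_zero _
    simp [h]
  rw [hη, ← Matrix.sum_star_mul_eq_trace, sum_pi_fin_add_two]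
  refine Finset.sum_congr rfl fun q _ => Finset.sum_congr rfl fun z _ => ?_
  rw [sum_pi_fin_add_two]
  refine congrArg (_ * ·) (Finset.sum_congr rfl fun p _ => Finset.sum_congr rfl fun z' _ => ?_)
  change O q p * (if ∀ j : Fin (m + 2), j ≠ 0 → j ≠ 1 → join q z j = join p z' j then 1 else 0) *
    ψ (join p z') = _
  simp only [hif]
  rfl
end

section
/- Let k ≥ 1 be an integer, β : ZMod k → ℝ, r ∈ ZMod k, and let ρ be any complex matrix indexed by (ZMod k)². Then Tr( ρ · (B(−β) ⊗ B(−β)) · (Z^r ⊗ (Z^r)⁻¹) · (B(β) ⊗ B(β)) ) = Σ_{p,q ∈ ZMod k} e^{i(β_p + β_q − β_{p+r} − β_{q−r})} · ⟨φ_p ⊗ φ_q, ρ (φ_{p+r} ⊗ φ_{q−r})⟩. -/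
open Matrix Kronecker

/-- `ω = exp(2πi/k)`. -/
noncomputable def omegaK (k : ℕ) : ℂ := Complex.exp (2 * Real.pi * Complex.I / k)

/-- The generalized Pauli-Z matrix, diagonal with `Z_{a,a} = ω^a`. -/
noncomputable def PauliZ (k : ℕ) [NeZero k] : Matrix (ZMod k) (ZMod k) ℂ :=
  Matrix.diagonal fun a => omegaK k ^ a.val

/-- The uniform superposition `|+⟩`, with all entries `k^{-1/2}`. -/
noncomputable def plusVec (k : ℕ) [NeZero k] : ZMod k → ℂ :=
  fun _ => ((Real.sqrt k : ℝ) : ℂ)⁻¹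

/-- `φ_a = Z^a |+⟩`. -/
noncomputable def phiVec (k : ℕ) [NeZero k] (a : ZMod k) : ZMod k → ℂ :=
  (PauliZ k ^ a.val).mulVec (plusVec k)

/-- `B(β) = Σ_{a ∈ ZMod k} e^{iβ_a} φ_a φ_a^†`. -/
noncomputable def Bmat (k : ℕ) [NeZero k] (β : ZMod k → ℝ) :
    Matrix (ZMod k) (ZMod k) ℂ :=
  ∑ a : ZMod k, Complex.exp (Complex.I * (β a : ℂ)) •
    Matrix.vecMulVec (phiVec k a) (fun d => (starRingEnd ℂ) (phiVec k a d))

/-- The tensor product of two vectors in `ℂ^k`. -/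
noncomputable def tensVec (k : ℕ) [NeZero k] (u v : ZMod k → ℂ) :
    ZMod k × ZMod k → ℂ :=
  fun x => u x.1 * v x.2

theorem omegaK_pow_val (k : ℕ) [NeZero k] (a : ZMod k) :
    omegaK k ^ a.val = ZMod.stdAddChar a := by
  have h := ZMod.stdAddChar_coe (N := k) (a.val : ℤ)
  rw [Int.cast_natCast, ZMod.natCast_zmod_val] at h
  rw [h, omegaK, ← Complex.exp_nat_mul]
  congr 1
  push_cast
  ring

theorem PauliZ_pow_val (k : ℕ) [NeZero k] (a : ZMod k) :
    PauliZ k ^ a.val = Matrix.diagonal fun d => ZMod.stdAddChar (d * a) := by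
  rw [PauliZ, Matrix.diagonal_pow]
  congr 1
  funext d
  rw [Pi.pow_apply, omegaK_pow_val, ← AddChar.map_nsmul_eq_pow, nsmul_eq_mul,
    ZMod.natCast_zmod_val, mul_comm]

theorem PauliZ_pow_val_mul (k : ℕ) [NeZero k] (a b : ZMod k) :
    PauliZ k ^ a.val * PauliZ k ^ b.val = PauliZ k ^ (a + b).val := by
  simp only [PauliZ_pow_val, Matrix.diagonal_mul_diagonal, mul_add, AddChar.map_add_eq_mul]

theorem PauliZ_pow_val_inv (k : ℕ) [NeZero k] (a : ZMod k) :
    (PauliZ k ^ a.val)⁻¹ = PauliZ k ^ (-a).val := by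
  apply Matrix.inv_eq_right_inv
  rw [PauliZ_pow_val_mul, add_neg_cancel, ZMod.val_zero, pow_zero]

theorem PauliZ_pow_val_mulVec_phiVec (k : ℕ) [NeZero k] (r a : ZMod k) :
    PauliZ k ^ r.val *ᵥ phiVec k a = phiVec k (a + r) := by
  rw [phiVec, Matrix.mulVec_mulVec, PauliZ_pow_val_mul, add_comm, phiVec]

theorem phiVec_apply (k : ℕ) [NeZero k] (a d : ZMod k) :
    phiVec k a d = ZMod.stdAddChar (d * a) * ((Real.sqrt k : ℝ) : ℂ)⁻¹ := by
  rw [phiVec, PauliZ_pow_val, Matrix.mulVec_diagonal, plusVec]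

theorem star_phiVec_dotProduct_phiVec (k : ℕ) [NeZero k] (a b : ZMod k) :
    star (phiVec k a) ⬝ᵥ phiVec k b = if a = b then 1 else 0 := by
  have hk : ((Real.sqrt k : ℝ) : ℂ)⁻¹ * ((Real.sqrt k : ℝ) : ℂ)⁻¹ = (k : ℂ)⁻¹ := by
    rw [← mul_inv, ← Complex.ofReal_mul, Real.mul_self_sqrt k.cast_nonneg, Complex.ofReal_natCast]
  have hterm (d : ZMod k) : star (phiVec k a) d * phiVec k b d =
      ZMod.stdAddChar (d * (b - a)) * (k : ℂ)⁻¹ := by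
    rw [Pi.star_apply, phiVec_apply, phiVec_apply, star_mul', ← starRingEnd_apply,
      ← starRingEnd_apply, ← AddChar.map_neg_eq_conj, map_inv₀, Complex.conj_ofReal, ← hk,
      mul_sub, sub_eq_neg_add, AddChar.map_add_eq_mul]
    ring
  rw [dotProduct, Finset.sum_congr rfl fun d _ => hterm d, ← Finset.sum_mul,
    AddChar.sum_mulShift (b - a) (ZMod.isPrimitive_stdAddChar k), ZMod.card]
  simp only [sub_eq_zero, eq_comm (a := b)]
  split_ifs <;> simp [NeZero.ne k]

theorem Bmat_mul_PauliZ_mul_Bmat (k : ℕ) [NeZero k] (β : ZMod k → ℝ) (r : ZMod k) :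
    Bmat k (fun a => -(β a)) * PauliZ k ^ r.val * Bmat k β =
      ∑ p, Complex.exp (Complex.I * ((β p - β (p + r) : ℝ) : ℂ)) •
        Matrix.vecMulVec (phiVec k (p + r)) (star (phiVec k p)) := by
  have hB (γ : ZMod k → ℝ) : Bmat k γ = ∑ a, Complex.exp (Complex.I * (γ a : ℂ)) •
    Matrix.vecMulVec (phiVec k a) (star (phiVec k a)) := rfl
  rw [mul_assoc, hB β, Finset.mul_sum, Finset.mul_sum]
  refine Finset.sum_congr rfl fun p _ => ?_
  rw [Matrix.mul_smul, Matrix.mul_smul, Matrix.mul_vecMulVec, PauliZ_pow_val_mulVec_phiVec, hB,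
    Finset.sum_mul, Finset.sum_eq_single (p + r)]
  · rw [Matrix.smul_mul, Matrix.vecMulVec_mul_vecMulVec, star_phiVec_dotProduct_phiVec, if_pos rfl,
      one_smul, smul_smul, ← Complex.exp_add]
    congr 2
    push_cast
    ring
  · intro a _ ha
    rw [Matrix.smul_mul, Matrix.vecMulVec_mul_vecMulVec, star_phiVec_dotProduct_phiVec, if_neg ha]
    simp
  · simp

theorem vecMulVec_kronecker_vecMulVec (k : ℕ) [NeZero k] (u v u' v' : ZMod k → ℂ) :
    Matrix.vecMulVec u v ⊗ₖ Matrix.vecMulVec u' v' =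
      Matrix.vecMulVec (tensVec k u u') (tensVec k v v') := by
  ext x y
  simp only [Matrix.kroneckerMap_apply, Matrix.vecMulVec_apply, tensVec]
  ring

/-- `Tr(ρ (B(-β) ⊗ B(-β)) (Z^r ⊗ (Z^r)⁻¹) (B(β) ⊗ B(β)))
  = Σ_{p,q} e^{i(β_p + β_q - β_{p+r} - β_{q-r})} ⟨φ_p ⊗ φ_q, ρ (φ_{p+r} ⊗ φ_{q-r})⟩`. -/
theorem trace_ZZ_expectation (k : ℕ) [NeZero k] (β : ZMod k → ℝ) (r : ZMod k)
    (ρ : Matrix (ZMod k × ZMod k) (ZMod k × ZMod k) ℂ) :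
    Matrix.trace
        (ρ * (Bmat k (fun a => -(β a)) ⊗ₖ Bmat k (fun a => -(β a))) *
          ((PauliZ k ^ r.val) ⊗ₖ (PauliZ k ^ r.val)⁻¹) * (Bmat k β ⊗ₖ Bmat k β))
      = ∑ p : ZMod k, ∑ q : ZMod k,
          Complex.exp (Complex.I * ((β p + β q - β (p + r) - β (q - r) : ℝ) : ℂ)) *
            ∑ x : ZMod k × ZMod k,
              (starRingEnd ℂ) (tensVec k (phiVec k p) (phiVec k q) x) *
                ρ.mulVec (tensVec k (phiVec k (p + r)) (phiVec k (q - r))) x := by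
  have hsum (F G : ZMod k → Matrix (ZMod k) (ZMod k) ℂ) :
      (∑ p, F p) ⊗ₖ (∑ q, G q) = ∑ p, ∑ q, F p ⊗ₖ G q := by
    ext x y
    simp only [Matrix.kroneckerMap_apply, Matrix.sum_apply, Finset.sum_mul_sum]
  rw [mul_assoc, mul_assoc, ← mul_assoc (Bmat k _ ⊗ₖ _), ← Matrix.mul_kronecker_mul,
    ← Matrix.mul_kronecker_mul, PauliZ_pow_val_inv, Bmat_mul_PauliZ_mul_Bmat,
    Bmat_mul_PauliZ_mul_Bmat, hsum]
  simp only [Finset.mul_sum, Matrix.trace_sum]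
  refine Finset.sum_congr rfl fun p _ => Finset.sum_congr rfl fun q _ => ?_
  rw [Matrix.smul_kronecker, Matrix.kronecker_smul, vecMulVec_kronecker_vecMulVec, smul_smul,
    ← Complex.exp_add, Matrix.mul_smul, Matrix.trace_smul, Matrix.mul_vecMulVec,
    Matrix.trace_vecMulVec, smul_eq_mul, ← sub_eq_add_neg, ← Finset.mul_sum]
  congr 1
  · congr 1
    push_cast
    ring
  · refine Finset.sum_congr rfl fun x _ => ?_
    simp only [tensVec, map_mul, Pi.star_apply, starRingEnd_apply]
    ring
end
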